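/- Let ξ, ξ_1, ξ_2, ... be point processes on ℝ, each almost surely infinite in both directions, and suppose that almost surely ξ({0}) = 0. Then the following are equivalent: (i) ξ_ℓ converges in distribution to ξ; (ii) for every positive integer K, the random vectors (x_{−K}(ξ_ℓ), ..., x_K(ξ_ℓ)) converge in distribution to (x_{−K}(ξ), ..., x_K(ξ)), i.e. E[F(x_{−K}(ξ_ℓ),...,x_K(ξ_ℓ))] → E[F(x_{−K}(ξ),...,x_K(ξ))] for every bounded continuous F : ℝ^{2K+1} → ℝ. -/

import Mathlib

open MeasureTheory Filter Topology Bornology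

noncomputable def xLabel (μ : MeasureTheory.Measure ℝ) (n : ℤ) : ℝ :=
  if 0 < n then sInf {x : ℝ | 0 < x ∧ (n.toNat : ENNReal) ≤ μ (Set.Ioc 0 x)}
  else sSup {x : ℝ | x ≤ 0 ∧ ((1 - n).toNat : ENNReal) ≤ μ (Set.Ioc x 0)}

def IsPointMeasure (μ : MeasureTheory.Measure ℝ) : Prop :=
  ∀ B : Set ℝ, MeasurableSet B → IsBounded B → ∃ m : ℕ, μ B = m

def InfiniteBothDirections (μ : MeasureTheory.Measure ℝ) : Prop :=
  μ (Set.Iio 0) = ⊤ ∧ μ (Set.Ioi 0) = ⊤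

section ConvergenceInDistribution

variable {Ω : Type*} [MeasurableSpace Ω] {P : Measure Ω} [IsProbabilityMeasure P]

/-- Convergence in distribution expressed through integrals of bounded continuous functions. -/
theorem tendstoInDistribution_iff_integral {E : Type*} [TopologicalSpace E] [MeasurableSpace E]
    [BorelSpace E] {X : ℕ → Ω → E} {Z : Ω → E} (hX : ∀ n, AEMeasurable (X n) P)
    (hZ : AEMeasurable Z P) :
    TendstoInDistribution X atTop Z (fun _ ↦ P) P ↔
      ∀ F : BoundedContinuousFunction E ℝ,
        Tendsto (fun n ↦ ∫ ω, F (X n ω) ∂P) atTop (𝓝 (∫ ω, F (Z ω) ∂P)) := by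
  have key (F : BoundedContinuousFunction E ℝ) {Y : Ω → E} (hY : AEMeasurable Y P) :
      ∫ x, F x ∂(P.map Y) = ∫ ω, F (Y ω) ∂P :=
    integral_map hY F.continuous.measurable.aestronglyMeasurable
  constructor
  · intro h F
    have := ProbabilityMeasure.tendsto_iff_forall_integral_tendsto.mp h.tendsto F
    simpa [key F hZ, key F (hX _)] using this
  · intro h
    refine ⟨hX, hZ, ProbabilityMeasure.tendsto_iff_forall_integral_tendsto.mpr fun F ↦ ?_⟩
    simpa [key F hZ, key F (hX _)] using h F

/-- Convergence in distribution expressed through the measures of open sets. -/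
theorem tendstoInDistribution_iff_le_liminf {E : Type*} [TopologicalSpace E] [MeasurableSpace E]
    [BorelSpace E] [HasOuterApproxClosed E] {X : ℕ → Ω → E} {Z : Ω → E}
    (hX : ∀ n, AEMeasurable (X n) P) (hZ : AEMeasurable Z P) :
    TendstoInDistribution X atTop Z (fun _ ↦ P) P ↔
      ∀ G : Set E, IsOpen G → P (Z ⁻¹' G) ≤ liminf (fun n ↦ P (X n ⁻¹' G)) atTop := by
  have key {G : Set E} (hG : IsOpen G) {Y : Ω → E} (hY : AEMeasurable Y P) :
      P.map Y G = P (Y ⁻¹' G) := Measure.map_apply_of_aemeasurable hY hG.measurableSet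
  constructor
  · intro h G hG
    have := ProbabilityMeasure.le_liminf_measure_open_of_tendsto h.tendsto hG
    simpa [key hG hZ, key hG (hX _)] using this
  · intro h
    refine ⟨hX, hZ, tendsto_of_forall_isOpen_le_liminf' fun G hG ↦ ?_⟩
    simpa [key hG hZ, key hG (hX _)] using h G hG

/-- The **Cramér–Wold theorem**. -/
theorem tendstoInDistribution_pi_of_linear_combinations {ι : Type*} [Fintype ι]
    {X : ℕ → Ω → ι → ℝ} {Z : Ω → ι → ℝ} (hX : ∀ n, AEMeasurable (X n) P)
    (hZ : AEMeasurable Z P)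
    (h : ∀ t : ι → ℝ, TendstoInDistribution (fun n ω ↦ ∑ i, t i * X n ω i) atTop
      (fun ω ↦ ∑ i, t i * Z ω i) (fun _ ↦ P) P) :
    TendstoInDistribution X atTop Z (fun _ ↦ P) P := by
  have hm : Measurable (WithLp.toLp 2 : (ι → ℝ) → EuclideanSpace ℝ ι) :=
    (PiLp.continuous_toLp 2 _).measurable
  have hX' (n : ℕ) : AEMeasurable (fun ω ↦ (WithLp.toLp 2 (X n ω) : EuclideanSpace ℝ ι)) P :=
    hm.comp_aemeasurable (hX n)
  have hZ' : AEMeasurable (fun ω ↦ (WithLp.toLp 2 (Z ω) : EuclideanSpace ℝ ι)) P :=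
    hm.comp_aemeasurable hZ
  have hEuclid : TendstoInDistribution
      (fun n ω ↦ (WithLp.toLp 2 (X n ω) : EuclideanSpace ℝ ι)) atTop
      (fun ω ↦ (WithLp.toLp 2 (Z ω) : EuclideanSpace ℝ ι)) (fun _ ↦ P) P := by
    refine ⟨hX', hZ', ProbabilityMeasure.tendsto_of_tendsto_charFun fun t ↦ ?_⟩
    have key {Y : Ω → ι → ℝ}
        (hY : AEMeasurable (fun ω ↦ (WithLp.toLp 2 (Y ω) : EuclideanSpace ℝ ι)) P)
        (hY' : AEMeasurable (fun ω ↦ ∑ i, t i * Y ω i) P) :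
        charFun (P.map fun ω ↦ (WithLp.toLp 2 (Y ω) : EuclideanSpace ℝ ι)) t =
          charFun (P.map fun ω ↦ ∑ i, t i * Y ω i) 1 := by
      rw [charFun_apply, charFun_apply_real, integral_map hY (by fun_prop),
        integral_map hY' (by fun_prop)]
      refine integral_congr_ae (.of_forall fun ω ↦ ?_)
      simp [PiLp.inner_apply]
    have := ProbabilityMeasure.tendsto_iff_tendsto_charFun.mp (h t).tendsto 1
    simp only [ProbabilityMeasure.coe_mk] at this ⊢
    rw [key hZ' (h t).aemeasurable_limit]
    simpa only [key (hX' _) ((h t).forall_aemeasurable _)] using this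
  exact hEuclid.continuous_comp (PiLp.continuous_ofLp 2 _)

/-- Convergence in distribution in a countable power of `ℝ` follows from the convergence of the
finite-dimensional marginals. -/
theorem tendstoInDistribution_pi_of_finset_restrict {ι : Type*} [Countable ι]
    {X : ℕ → Ω → ι → ℝ} {Z : Ω → ι → ℝ} (hX : ∀ n, AEMeasurable (X n) P)
    (hZ : AEMeasurable Z P)
    (h : ∀ s : Finset ι, TendstoInDistribution (fun n ω ↦ s.restrict (X n ω)) atTop
      (fun ω ↦ s.restrict (Z ω)) (fun _ ↦ P) P) :
    TendstoInDistribution X atTop Z (fun _ ↦ P) P := by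
  let := TopologicalSpace.pseudoMetrizableSpacePseudoMetric (ι → ℝ)
  rw [tendstoInDistribution_iff_le_liminf hX hZ]
  intro G hG
  let U (s : Finset ι) : Set (s → ℝ) := interior {u | ∀ x : ι → ℝ, s.restrict x = u → x ∈ G}
  let C (s : Finset ι) : Set (ι → ℝ) := s.restrict ⁻¹' U s
  have hCG (s : Finset ι) : C s ⊆ G := fun x hx ↦ interior_subset hx x rfl
  have hCmono : Monotone C := by
    intro s t hst x hx
    refine mem_interior.mpr ⟨Finset.restrict₂ (π := fun _ ↦ ℝ) hst ⁻¹' U s, fun w hw y hy ↦ ?_,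
      isOpen_interior.preimage (Finset.continuous_restrict₂ hst), hx⟩
    refine interior_subset hw y ?_
    rw [← hy]
    rfl
  have hC : ⋃ s, C s = G := by
    refine Set.Subset.antisymm (Set.iUnion_subset hCG) fun x hx ↦ ?_
    obtain ⟨I, u, hu, huG⟩ := isOpen_pi_iff.mp hG x hx
    refine Set.mem_iUnion.mpr ⟨I, mem_interior.mpr ⟨Set.univ.pi fun i : I ↦ u i,
      fun w hw y hy ↦ huG fun i hi ↦ ?_,
      isOpen_set_pi Set.finite_univ fun i _ ↦ (hu i i.2).1, fun i _ ↦ (hu i i.2).2⟩⟩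
    have := hw ⟨i, hi⟩ trivial
    rwa [← hy] at this
  have hsup : P (Z ⁻¹' G) = ⨆ s, P (Z ⁻¹' C s) := by
    rw [← hC, Set.preimage_iUnion]
    exact Directed.measure_iUnion
      (Monotone.directed_le fun s t hst ↦ Set.preimage_mono (hCmono hst))
  rw [hsup]
  refine iSup_le fun s ↦ ?_
  have := (tendstoInDistribution_iff_le_liminf (h s).forall_aemeasurable
    (h s).aemeasurable_limit).mp (h s) (U s) isOpen_interior
  refine this.trans (liminf_le_liminf (.of_forall fun n ↦ measure_mono ?_))
  exact fun ω hω ↦ hCG s hω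

/-- A version of the **continuous mapping theorem**: `y` need only be continuous, along `S` and
with respect to the topology induced by `φ`, at almost every value of the limit. -/
theorem tendstoInDistribution_of_ae_tendsto_comap {E D Y : Type*}
    [TopologicalSpace D] [MeasurableSpace D] [BorelSpace D] [HasOuterApproxClosed D]
    [TopologicalSpace Y] [MeasurableSpace Y] [BorelSpace Y] [HasOuterApproxClosed Y]
    {ξs : ℕ → Ω → E} {ξ : Ω → E} {φ : E → D} {y : E → Y} {S : Set E}
    (hφ : TendstoInDistribution (fun n ω ↦ φ (ξs n ω)) atTop (fun ω ↦ φ (ξ ω)) (fun _ ↦ P) P)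
    (hys : ∀ n, AEMeasurable (fun ω ↦ y (ξs n ω)) P) (hy : AEMeasurable (fun ω ↦ y (ξ ω)) P)
    (hS : ∀ n, ∀ᵐ ω ∂P, ξs n ω ∈ S)
    (hc : ∀ᵐ ω ∂P, Tendsto y (comap φ (𝓝 (φ (ξ ω))) ⊓ 𝓟 S) (𝓝 (y (ξ ω)))) :
    TendstoInDistribution (fun n ω ↦ y (ξs n ω)) atTop (fun ω ↦ y (ξ ω)) (fun _ ↦ P) P := by
  rw [tendstoInDistribution_iff_le_liminf hys hy]
  intro G hG
  let V : Set D := interior {v | ∀ e ∈ S, φ e = v → y e ∈ G}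
  calc P ((fun ω ↦ y (ξ ω)) ⁻¹' G) ≤ P ((fun ω ↦ φ (ξ ω)) ⁻¹' V) := by
        refine measure_mono_ae ?_
        filter_upwards [hc] with ω hω hωG
        have := hω (hG.mem_nhds hωG)
        rw [mem_map, mem_inf_principal, mem_comap] at this
        obtain ⟨t, ht, hts⟩ := this
        refine mem_interior_iff_mem_nhds.mpr (mem_of_superset ht ?_)
        rintro v hv e he rfl
        exact hts hv he
    _ ≤ liminf (fun n ↦ P ((fun ω ↦ φ (ξs n ω)) ⁻¹' V)) atTop :=
        (tendstoInDistribution_iff_le_liminf hφ.forall_aemeasurable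
          hφ.aemeasurable_limit).mp hφ V isOpen_interior
    _ ≤ liminf (fun n ↦ P ((fun ω ↦ y (ξs n ω)) ⁻¹' G)) atTop := by
        refine liminf_le_liminf (.of_forall fun n ↦ measure_mono_ae ?_)
        filter_upwards [hS n] with ω hω hωV
        exact interior_subset hωV _ hω rfl

end ConvergenceInDistribution

section PointMeasure

variable {μ : Measure ℝ}

theorem IsPointMeasure.isLocallyFiniteMeasure (hμ : IsPointMeasure μ) :
    IsLocallyFiniteMeasure μ := by
  refine ⟨fun x ↦ ⟨Metric.ball x 1, Metric.ball_mem_nhds x one_pos, ?_⟩⟩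
  obtain ⟨m, hm⟩ := hμ (Metric.ball x 1) measurableSet_ball Metric.isBounded_ball
  exact hm ▸ ENNReal.natCast_lt_top m

theorem IsPointMeasure.eq_zero_of_lt_one (hμ : IsPointMeasure μ) {B : Set ℝ}
    (hB : MeasurableSet B) (hb : IsBounded B) (h : μ B < 1) : μ B = 0 := by
  obtain ⟨m, hm⟩ := hμ B hB hb
  rw [hm] at h ⊢
  have : m < 1 := by exact_mod_cast h
  simp [Nat.lt_one_iff.mp this]

/-- A point measure without an atom at `a` does not charge a neighbourhood of `a`. -/
theorem IsPointMeasure.exists_ball_eq_zero (hμ : IsPointMeasure μ) {a : ℝ} (ha : μ {a} = 0) :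
    ∃ δ > 0, μ (Metric.ball a δ) = 0 := by
  have := hμ.isLocallyFiniteMeasure
  obtain ⟨U, haU, hU, hμU⟩ := Set.exists_isOpen_lt_of_lt {a} 1 (by simp [ha] : μ {a} < 1)
  obtain ⟨δ, hδ, hball⟩ := Metric.isOpen_iff.mp hU a (haU rfl)
  exact ⟨δ, hδ, hμ.eq_zero_of_lt_one measurableSet_ball Metric.isBounded_ball
    ((measure_mono hball).trans_lt hμU)⟩

theorem IsPointMeasure.exists_Ioc_eq_zero (hμ : IsPointMeasure μ) (t : ℝ) :
    ∃ s > t, μ (Set.Ioc t s) = 0 := by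
  have hν : IsPointMeasure (μ.restrict (Set.Ioi t)) := by
    intro B hB hb
    rw [Measure.restrict_apply hB]
    exact hμ _ (hB.inter measurableSet_Ioi) (hb.subset Set.inter_subset_left)
  obtain ⟨δ, hδ, h⟩ := hν.exists_ball_eq_zero (a := t) (by simp)
  refine ⟨t + δ / 2, by linarith, ?_⟩
  rw [Measure.restrict_apply measurableSet_ball] at h
  refine measure_mono_null (t := Metric.ball t δ ∩ Set.Ioi t) (fun x hx ↦ ⟨?_, hx.1⟩) h
  rw [Metric.mem_ball, Real.dist_eq, abs_lt]
  constructor <;> linarith [hx.1, hx.2]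

/-- The signed number of points of `μ` between `0` and `t`, so that `μ (a, b]` is the increment
of `labelCount μ` from `a` to `b`. -/
noncomputable def labelCount (μ : Measure ℝ) (t : ℝ) : ℤ :=
  if 0 ≤ t then ⌊μ.real (Set.Ioc 0 t)⌋ else -⌊μ.real (Set.Ioc t 0)⌋

theorem measurable_labelCount (t : ℝ) : Measurable fun μ : Measure ℝ ↦ labelCount μ t := by
  have h (B : Set ℝ) (hB : MeasurableSet B) : Measurable fun μ : Measure ℝ ↦ ⌊μ.real B⌋ :=
    (Measure.measurable_coe hB).ennreal_toReal.floor
  unfold labelCount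
  split_ifs
  · exact h _ measurableSet_Ioc
  · exact (h _ measurableSet_Ioc).neg

@[simp]
theorem labelCount_zero : labelCount μ 0 = 0 := by simp [labelCount]

theorem IsPointMeasure.floor_real_Ioc (hμ : IsPointMeasure μ) (a b : ℝ) :
    (⌊μ.real (Set.Ioc a b)⌋ : ℝ) = μ.real (Set.Ioc a b) := by
  obtain ⟨m, hm⟩ := hμ _ measurableSet_Ioc (Metric.isBounded_Ioc a b)
  simp [measureReal_def, hm]

theorem IsPointMeasure.real_Ioc (hμ : IsPointMeasure μ) {a b : ℝ} (hab : a ≤ b) :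
    μ.real (Set.Ioc a b) = labelCount μ b - labelCount μ a := by
  have := hμ.isLocallyFiniteMeasure
  have add {a b c : ℝ} (hab : a ≤ b) (hbc : b ≤ c) :
      μ.real (Set.Ioc a c) = μ.real (Set.Ioc a b) + μ.real (Set.Ioc b c) := by
    rw [← Set.Ioc_union_Ioc_eq_Ioc hab hbc]
    exact measureReal_union (Set.Ioc_disjoint_Ioc_of_le le_rfl) measurableSet_Ioc
      measure_Ioc_lt_top.ne measure_Ioc_lt_top.ne
  unfold labelCount
  split_ifs with hb ha ha
  · simp only [hμ.floor_real_Ioc]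
    linarith [add ha hab]
  · push_cast
    simp only [hμ.floor_real_Ioc]
    linarith [add (not_le.mp ha).le hb]
  · linarith
  · push_cast
    simp only [hμ.floor_real_Ioc]
    linarith [add hab (not_le.mp hb).le]

theorem IsPointMeasure.monotone_labelCount (hμ : IsPointMeasure μ) : Monotone (labelCount μ) := by
  intro a b hab
  have := hμ.real_Ioc hab
  have h0 : 0 ≤ μ.real (Set.Ioc a b) := measureReal_nonneg
  exact_mod_cast (by linarith : (labelCount μ a : ℝ) ≤ labelCount μ b)

theorem IsPointMeasure.measure_Ioc (hμ : IsPointMeasure μ) {a b : ℝ} (hab : a ≤ b) :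
    μ (Set.Ioc a b) = ((labelCount μ b - labelCount μ a).toNat : ENNReal) := by
  obtain ⟨m, hm⟩ := hμ _ measurableSet_Ioc (Metric.isBounded_Ioc a b)
  have h := hμ.real_Ioc hab
  rw [measureReal_def, hm] at h
  have h' : (m : ℤ) = labelCount μ b - labelCount μ a := by exact_mod_cast h
  rw [hm, ← h', Int.toNat_natCast]

theorem IsPointMeasure.exists_gt_labelCount_eq (hμ : IsPointMeasure μ) (t : ℝ) :
    ∃ s > t, labelCount μ s = labelCount μ t := by
  obtain ⟨s, hs, h⟩ := hμ.exists_Ioc_eq_zero t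
  refine ⟨s, hs, ?_⟩
  have := hμ.real_Ioc (le_of_lt hs)
  rw [measureReal_def, h] at this
  exact_mod_cast sub_eq_zero.mp (by simpa using this.symm :
    (labelCount μ s : ℝ) - labelCount μ t = 0)

theorem IsPointMeasure.exists_le_labelCount (hμ : IsPointMeasure μ)
    (hinf : InfiniteBothDirections μ) (n : ℤ) : ∃ t > 0, n ≤ labelCount μ t := by
  have hU : ⋃ k : ℕ, Set.Ioc (0 : ℝ) (k + 1) = Set.Ioi 0 := by
    ext x
    simp only [Set.mem_iUnion, Set.mem_Ioc, Set.mem_Ioi]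
    refine ⟨fun ⟨_, h⟩ ↦ h.1, fun h ↦ ?_⟩
    obtain ⟨k, hk⟩ := exists_nat_ge x
    exact ⟨k, h, by linarith⟩
  have hmono : Monotone fun k : ℕ ↦ Set.Ioc (0 : ℝ) (k + 1) := fun i j hij ↦
    Set.Ioc_subset_Ioc_right (by simpa using hij)
  have := tendsto_measure_iUnion_atTop (μ := μ) hmono
  rw [hU, hinf.2] at this
  obtain ⟨k, hk⟩ := (this.eventually (lt_mem_nhds
    (ENNReal.natCast_lt_top n.toNat))).exists
  have hk0 : (0 : ℝ) < k + 1 := by positivity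
  refine ⟨k + 1, hk0, ?_⟩
  rw [Function.comp_apply, hμ.measure_Ioc hk0.le, Nat.cast_lt, labelCount_zero] at hk
  omega

theorem IsPointMeasure.exists_labelCount_lt (hμ : IsPointMeasure μ)
    (hinf : InfiniteBothDirections μ) (n : ℤ) : ∃ t < 0, labelCount μ t < n := by
  have hU : ⋃ k : ℕ, Set.Ioc (-(k + 1) : ℝ) 0 = Set.Iic 0 := by
    ext x
    simp only [Set.mem_iUnion, Set.mem_Ioc, Set.mem_Iic]
    refine ⟨fun ⟨_, h⟩ ↦ h.2, fun h ↦ ?_⟩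
    obtain ⟨k, hk⟩ := exists_nat_ge (-x)
    exact ⟨k, by linarith, h⟩
  have hmono : Monotone fun k : ℕ ↦ Set.Ioc (-(k + 1) : ℝ) 0 := fun i j hij ↦
    Set.Ioc_subset_Ioc_left (neg_le_neg (by simpa using hij))
  have := tendsto_measure_iUnion_atTop (μ := μ) hmono
  rw [hU, top_unique (hinf.1.symm.le.trans (measure_mono Set.Iio_subset_Iic_self))] at this
  obtain ⟨k, hk⟩ := (this.eventually (lt_mem_nhds
    (ENNReal.natCast_lt_top (-n).toNat))).exists
  have hk0 : (-(k + 1) : ℝ) < 0 := by linarith [(k.cast_nonneg : (0 : ℝ) ≤ k)]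
  refine ⟨-(k + 1), hk0, ?_⟩
  rw [Function.comp_apply, hμ.measure_Ioc hk0.le, Nat.cast_lt, labelCount_zero] at hk
  omega

/-- The labelling and the counting function of a point measure form a Galois connection. -/
theorem IsPointMeasure.xLabel_le_iff (hμ : IsPointMeasure μ) (hinf : InfiniteBothDirections μ)
    (n : ℤ) (t : ℝ) : xLabel μ n ≤ t ↔ n ≤ labelCount μ t := by
  have hmono := hμ.monotone_labelCount
  obtain ⟨s, hts, hs⟩ := hμ.exists_gt_labelCount_eq t
  unfold xLabel
  split_ifs with hn
  · have hA : {x : ℝ | 0 < x ∧ (n.toNat : ENNReal) ≤ μ (Set.Ioc 0 x)} =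
        {x | 0 < x ∧ n ≤ labelCount μ x} := by
      ext x
      refine and_congr_right fun hx ↦ ?_
      rw [hμ.measure_Ioc hx.le, Nat.cast_le, labelCount_zero]
      omega
    have hbdd : BddBelow {x | 0 < x ∧ n ≤ labelCount μ x} := ⟨0, fun x hx ↦ hx.1.le⟩
    have hne : {x | 0 < x ∧ n ≤ labelCount μ x}.Nonempty := hμ.exists_le_labelCount hinf n
    rw [hA]
    constructor
    · intro h
      by_contra! hlt
      refine absurd (le_csInf hne fun x hx ↦ ?_) (not_le.mpr (h.trans_lt hts))
      by_contra! hxs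
      have := hmono hxs.le
      have := hx.2
      omega
    · intro h
      refine csInf_le hbdd ⟨?_, h⟩
      by_contra! ht
      have := hmono ht
      rw [labelCount_zero] at this
      omega
  · have hA : {x : ℝ | x ≤ 0 ∧ ((1 - n).toNat : ENNReal) ≤ μ (Set.Ioc x 0)} =
        {x | x ≤ 0 ∧ labelCount μ x < n} := by
      ext x
      refine and_congr_right fun hx ↦ ?_
      rw [hμ.measure_Ioc hx, Nat.cast_le, labelCount_zero]
      have := hmono hx
      rw [labelCount_zero] at this
      omega
    have hbdd : BddAbove {x | x ≤ 0 ∧ labelCount μ x < n} := ⟨0, fun x hx ↦ hx.1⟩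
    have hne : {x | x ≤ 0 ∧ labelCount μ x < n}.Nonempty :=
      (hμ.exists_labelCount_lt hinf n).imp fun x hx ↦ ⟨hx.1.le, hx.2⟩
    rw [hA]
    constructor
    · intro h
      by_contra! hlt
      refine absurd (le_csSup hbdd ⟨?_, hs.trans_lt hlt⟩) (not_le.mpr (h.trans_lt hts))
      by_contra! hs0
      have := hmono hs0.le
      rw [labelCount_zero] at this
      omega
    · intro h
      refine csSup_le hne fun x hx ↦ ?_
      by_contra! htx
      have := hmono htx.le
      have := hx.2
      omega

theorem IsPointMeasure.lt_xLabel_iff (hμ : IsPointMeasure μ) (hinf : InfiniteBothDirections μ)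
    (n : ℤ) (t : ℝ) : t < xLabel μ n ↔ labelCount μ t < n := by
  rw [← not_le, hμ.xLabel_le_iff hinf, not_le]

theorem IsPointMeasure.monotone_xLabel (hμ : IsPointMeasure μ)
    (hinf : InfiniteBothDirections μ) : Monotone (xLabel μ) := fun m n hmn ↦
  (hμ.xLabel_le_iff hinf m _).mpr (hmn.trans ((hμ.xLabel_le_iff hinf n _).mp le_rfl))

/-- A point measure is the sum of the Dirac masses at its labelled points. -/
theorem IsPointMeasure.eq_sum_dirac (hμ : IsPointMeasure μ) (hinf : InfiniteBothDirections μ) :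
    μ = Measure.sum fun n : ℤ ↦ Measure.dirac (xLabel μ n) := by
  have := hμ.isLocallyFiniteMeasure
  refine Measure.ext_of_Ioc _ _ fun a b hab ↦ ?_
  rw [Measure.sum_apply _ measurableSet_Ioc, hμ.measure_Ioc hab.le]
  have hind (n : ℤ) : Measure.dirac (xLabel μ n) (Set.Ioc a b) =
      if n ∈ Finset.Ioc (labelCount μ a) (labelCount μ b) then 1 else 0 := by
    rw [Measure.dirac_apply' _ measurableSet_Ioc, Set.indicator_apply]
    simp [hμ.xLabel_le_iff hinf, hμ.lt_xLabel_iff hinf]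
  simp only [hind]
  rw [tsum_eq_sum (s := Finset.Ioc (labelCount μ a) (labelCount μ b))
    (fun n hn ↦ by simp [hn])]
  rw [Finset.sum_ite_mem, Finset.inter_self]
  simp

theorem IsPointMeasure.integral_eq_sum (hμ : IsPointMeasure μ) (hinf : InfiniteBothDirections μ)
    {f : ℝ → ℝ} (hf : Continuous f) (hfc : HasCompactSupport f) {s : Finset ℤ}
    (hs : ∀ n ∉ s, f (xLabel μ n) = 0) : ∫ x, f x ∂μ = ∑ n ∈ s, f (xLabel μ n) := by
  have := hμ.isLocallyFiniteMeasure
  have hint : Integrable f μ := hf.integrable_of_hasCompactSupport hfc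
  have hsum := hμ.eq_sum_dirac hinf
  have h := hasSum_integral_measure (μ := fun n : ℤ ↦ Measure.dirac (xLabel μ n))
    (f := f) (by rwa [← hsum])
  rw [← hsum] at h
  simp only [integral_dirac] at h
  rw [← h.tsum_eq, tsum_eq_sum hs]

end PointMeasure

section Continuity

/-- A continuous bump supported in `[p, q]`, of height at most `1` and with slopes `k`. -/
noncomputable def trapezoid (i : ℚ × ℚ × ℕ) (x : ℝ) : ℝ :=
  max 0 (min 1 (i.2.2 * min (x - i.1) (i.2.1 - x)))

theorem continuous_trapezoid (i : ℚ × ℚ × ℕ) : Continuous (trapezoid i) := by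
  unfold trapezoid
  fun_prop

theorem trapezoid_nonneg (i : ℚ × ℚ × ℕ) (x : ℝ) : 0 ≤ trapezoid i x := le_max_left _ _

theorem trapezoid_le_one (i : ℚ × ℚ × ℕ) (x : ℝ) : trapezoid i x ≤ 1 :=
  max_le zero_le_one (min_le_left _ _)

theorem trapezoid_eq_zero {p q : ℚ} {k : ℕ} {x : ℝ} (h : x ≤ p ∨ q ≤ x) :
    trapezoid (p, q, k) x = 0 := by
  refine max_eq_left ((min_le_right _ _).trans
    (mul_nonpos_of_nonneg_of_nonpos k.cast_nonneg ?_))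
  rcases h with h | h
  · exact (min_le_left _ _).trans (sub_nonpos.mpr h)
  · exact (min_le_right _ _).trans (sub_nonpos.mpr h)

theorem trapezoid_eq_one {p q : ℚ} {k : ℕ} {x η : ℝ} (hη : 1 ≤ k * η) (hp : p + η ≤ x)
    (hq : x ≤ q - η) : trapezoid (p, q, k) x = 1 := by
  have : 1 ≤ (k : ℝ) * min (x - p) (q - x) :=
    hη.trans (mul_le_mul_of_nonneg_left (le_min (by linarith) (by linarith)) k.cast_nonneg)
  simp [trapezoid, min_eq_left this]

theorem hasCompactSupport_trapezoid (i : ℚ × ℚ × ℕ) : HasCompactSupport (trapezoid i) := by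
  refine HasCompactSupport.intro (isCompact_Icc (a := (i.1 : ℝ)) (b := i.2.1)) fun x hx ↦ ?_
  refine trapezoid_eq_zero (p := i.1) (q := i.2.1) (k := i.2.2) ?_
  by_contra! h
  exact hx (Set.mem_Icc.mpr ⟨h.1.le, h.2.le⟩)

theorem integrable_trapezoid (i : ℚ × ℚ × ℕ) (μ : Measure ℝ) [IsLocallyFiniteMeasure μ] :
    Integrable (trapezoid i) μ :=
  (continuous_trapezoid i).integrable_of_hasCompactSupport (hasCompactSupport_trapezoid i)

/-- The values of a measure on the countable family of trapezoids. -/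
noncomputable def trapezoidIntegrals (μ : Measure ℝ) (i : ℚ × ℚ × ℕ) : ℝ := ∫ x, trapezoid i x ∂μ

variable {μ₀ : Measure ℝ}

/-- An interval whose endpoints are not atoms of a point measure is sandwiched between two
trapezoids whose integrals equal the mass of the interval. -/
theorem IsPointMeasure.exists_trapezoid_sandwich (hμ : IsPointMeasure μ₀) {a b : ℝ}
    (ha : μ₀ {a} = 0) (hb : μ₀ {b} = 0) :
    ∃ i j, trapezoid i ≤ (Set.Ioc a b).indicator 1 ∧ (Set.Ioc a b).indicator 1 ≤ trapezoid j ∧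
      trapezoidIntegrals μ₀ i = μ₀.real (Set.Ioc a b) ∧
      trapezoidIntegrals μ₀ j = μ₀.real (Set.Ioc a b) := by
  obtain ⟨δa, hδa, hballa⟩ := hμ.exists_ball_eq_zero ha
  obtain ⟨δb, hδb, hballb⟩ := hμ.exists_ball_eq_zero hb
  have hae : ∀ᵐ x ∂μ₀, x ≤ a - δa ∨ b + δb ≤ x ∨ (a + δa ≤ x ∧ x ≤ b - δb) := by
    filter_upwards [measure_eq_zero_iff_ae_notMem.mp hballa,
      measure_eq_zero_iff_ae_notMem.mp hballb] with x hxa hxb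
    rw [Metric.mem_ball, Real.dist_eq, not_lt, le_abs] at hxa hxb
    by_contra! h
    rcases hxa with hxa | hxa <;> rcases hxb with hxb | hxb
    · linarith [h.2.1]
    · linarith [h.2.2 (by linarith)]
    · linarith [h.1]
    · linarith [h.1]
  have hint {f : ℝ → ℝ} (h1 : ∀ x, a + δa ≤ x → x ≤ b - δb → f x = 1)
      (h2 : ∀ x, x ≤ a - δa ∨ b + δb ≤ x → f x = 0) :
      ∫ x, f x ∂μ₀ = μ₀.real (Set.Ioc a b) := by
    rw [← integral_indicator_one measurableSet_Ioc]
    refine integral_congr_ae ?_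
    filter_upwards [hae] with x hx
    rcases hx with hx | hx | hx
    · rw [h2 x (.inl hx), Set.indicator_of_notMem fun h ↦ by linarith [h.1]]
    · rw [h2 x (.inr hx), Set.indicator_of_notMem fun h ↦ by linarith [h.2]]
    · rw [h1 x hx.1 hx.2,
        Set.indicator_of_mem (Set.mem_Ioc.mpr ⟨by linarith [hx.1], by linarith [hx.2]⟩)]
      rfl
  have hslope {η : ℝ} (hη : 0 < η) : ∃ k : ℕ, 1 ≤ k * η := by
    obtain ⟨k, hk⟩ := exists_nat_ge (1 / η)
    exact ⟨k, (div_le_iff₀ hη).mp hk⟩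
  obtain ⟨p, hp, hp'⟩ := exists_rat_btwn (show a < a + δa by linarith)
  obtain ⟨q, hq, hq'⟩ := exists_rat_btwn (show b - δb < b by linarith)
  obtain ⟨r, hr, hr'⟩ := exists_rat_btwn (show a - δa < a by linarith)
  obtain ⟨s, hs, hs'⟩ := exists_rat_btwn (show b < b + δb by linarith)
  obtain ⟨k, hk⟩ := hslope (lt_min (sub_pos.mpr hp') (sub_pos.mpr hq))
  obtain ⟨l, hl⟩ := hslope (lt_min (sub_pos.mpr hr') (sub_pos.mpr hs))
  have hk1 := min_le_left (a + δa - p) (q - (b - δb))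
  have hk2 := min_le_right (a + δa - p) (q - (b - δb))
  have hl1 := min_le_left (a - r) (s - b)
  have hl2 := min_le_right (a - r) (s - b)
  refine ⟨(p, q, k), (r, s, l), fun x ↦ ?_, Set.indicator_le' (fun x hx ↦ ?_)
    fun x _ ↦ trapezoid_nonneg _ x, hint ?_ ?_, hint ?_ ?_⟩
  · by_cases hx : x ∈ Set.Ioc a b
    · rw [Set.indicator_of_mem hx]
      exact trapezoid_le_one _ x
    · rw [Set.indicator_of_notMem hx]
      refine (trapezoid_eq_zero ?_).le
      by_contra! h
      exact hx ⟨by linarith [h.1], by linarith [h.2]⟩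
  · exact (trapezoid_eq_one hl (by linarith [hx.1]) (by linarith [hx.2])).ge
  · exact fun x h h' ↦ trapezoid_eq_one hk (by linarith) (by linarith)
  · exact fun x h ↦ trapezoid_eq_zero (h.imp (fun h ↦ by linarith) fun h ↦ by linarith)
  · exact fun x h h' ↦ trapezoid_eq_one hl (by linarith) (by linarith)
  · exact fun x h ↦ trapezoid_eq_zero (h.imp (fun h ↦ by linarith) fun h ↦ by linarith)

theorem tendsto_comap_apply {E ι : Type*} (φ : E → ι → ℝ) (e : E) (S : Set E) (i : ι) :
    Tendsto (fun e ↦ φ e i) (comap φ (𝓝 (φ e)) ⊓ 𝓟 S) (𝓝 (φ e i)) :=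
  (((continuous_apply i).tendsto _).comp tendsto_comap).mono_left inf_le_left

theorem IsPointMeasure.eventually_labelCount_sub_eq (hμ : IsPointMeasure μ₀) {a b : ℝ}
    (hab : a ≤ b) (ha : μ₀ {a} = 0) (hb : μ₀ {b} = 0) :
    ∀ᶠ μ in comap trapezoidIntegrals (𝓝 (trapezoidIntegrals μ₀)) ⊓ 𝓟 {μ | IsPointMeasure μ},
      labelCount μ b - labelCount μ a = labelCount μ₀ b - labelCount μ₀ a := by
  obtain ⟨i, j, hi, hj, hi0, hj0⟩ := hμ.exists_trapezoid_sandwich ha hb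
  have hti := tendsto_comap_apply trapezoidIntegrals μ₀ {μ | IsPointMeasure μ} i
  have htj := tendsto_comap_apply trapezoidIntegrals μ₀ {μ | IsPointMeasure μ} j
  filter_upwards [hti.eventually (lt_mem_nhds (sub_one_lt _)),
    htj.eventually (gt_mem_nhds (lt_add_one _)), mem_inf_of_right (mem_principal_self _)]
    with μ h1 h2 (h3 : IsPointMeasure μ)
  have := h3.isLocallyFiniteMeasure
  have hI : Integrable ((Set.Ioc a b).indicator (1 : ℝ → ℝ)) μ :=
    (integrable_indicator_iff measurableSet_Ioc).mpr
      (integrableOn_const measure_Ioc_lt_top.ne (by simp))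
  have hle := integral_mono (integrable_trapezoid i μ) hI hi
  have hge := integral_mono hI (integrable_trapezoid j μ) hj
  rw [integral_indicator_one measurableSet_Ioc, h3.real_Ioc hab] at hle hge
  rw [hi0, hμ.real_Ioc hab] at h1
  rw [hj0, hμ.real_Ioc hab] at h2
  have h1' := h1.trans_le hle
  have h2' := hge.trans_lt h2
  norm_cast at h1' h2'
  omega

theorem IsPointMeasure.eventually_labelCount_eq (hμ : IsPointMeasure μ₀) (h0 : μ₀ {0} = 0)
    {t : ℝ} (ht : μ₀ {t} = 0) :
    ∀ᶠ μ in comap trapezoidIntegrals (𝓝 (trapezoidIntegrals μ₀)) ⊓ 𝓟 {μ | IsPointMeasure μ},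
      labelCount μ t = labelCount μ₀ t := by
  rcases le_total 0 t with h | h
  · filter_upwards [hμ.eventually_labelCount_sub_eq h h0 ht] with μ hμ'
    simpa using hμ'
  · filter_upwards [hμ.eventually_labelCount_sub_eq h ht h0] with μ hμ'
    simpa using hμ'

theorem IsPointMeasure.exists_between_null_singleton (hμ : IsPointMeasure μ₀) {a b : ℝ}
    (hab : a < b) : ∃ t, μ₀ {t} = 0 ∧ a < t ∧ t < b := by
  have := hμ.isLocallyFiniteMeasure
  have hcount : {t : ℝ | 0 < μ₀ {t}}.Countable :=
    Measure.countable_meas_level_set_pos (g := id) measurable_id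
  obtain ⟨t, ht, hat, htb⟩ := (hcount.dense_compl ℝ).exists_between hab
  exact ⟨t, by simpa using ht, hat, htb⟩

/-- Labels depend continuously on the trapezoid integrals at point measures that do not
charge `0`. -/
theorem IsPointMeasure.tendsto_xLabel (hμ : IsPointMeasure μ₀) (hinf : InfiniteBothDirections μ₀)
    (h0 : μ₀ {0} = 0) (n : ℤ) :
    Tendsto (fun μ ↦ xLabel μ n) (comap trapezoidIntegrals (𝓝 (trapezoidIntegrals μ₀)) ⊓
      𝓟 {μ | IsPointMeasure μ ∧ InfiniteBothDirections μ}) (𝓝 (xLabel μ₀ n)) := by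
  have hle : comap trapezoidIntegrals (𝓝 (trapezoidIntegrals μ₀)) ⊓
      𝓟 {μ | IsPointMeasure μ ∧ InfiniteBothDirections μ} ≤
      comap trapezoidIntegrals (𝓝 (trapezoidIntegrals μ₀)) ⊓ 𝓟 {μ | IsPointMeasure μ} :=
    inf_le_inf_left _ (principal_mono.mpr fun _ h ↦ h.1)
  refine tendsto_order.mpr ⟨fun t ht ↦ ?_, fun t ht ↦ ?_⟩
  · obtain ⟨s, hs, hts, hsx⟩ := hμ.exists_between_null_singleton ht
    filter_upwards [hle (hμ.eventually_labelCount_eq h0 hs),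
      mem_inf_of_right (mem_principal_self _)] with μ h1 h2
    rw [hμ.lt_xLabel_iff hinf, ← h1, ← h2.1.lt_xLabel_iff h2.2] at hsx
    exact hts.trans hsx
  · obtain ⟨s, hs, hxs, hst⟩ := hμ.exists_between_null_singleton ht
    filter_upwards [hle (hμ.eventually_labelCount_eq h0 hs),
      mem_inf_of_right (mem_principal_self _)] with μ h1 h2
    have := hxs.le
    rw [hμ.xLabel_le_iff hinf, ← h1, ← h2.1.xLabel_le_iff h2.2] at this
    exact this.trans_lt hst

/-- Linear statistics depend continuously on the labels. -/
theorem IsPointMeasure.tendsto_integral (hμ : IsPointMeasure μ₀)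
    (hinf : InfiniteBothDirections μ₀) {f : ℝ → ℝ} (hf : Continuous f)
    (hfc : HasCompactSupport f) :
    Tendsto (fun μ ↦ ∫ x, f x ∂μ) (comap xLabel (𝓝 (xLabel μ₀)) ⊓
      𝓟 {μ | IsPointMeasure μ ∧ InfiniteBothDirections μ}) (𝓝 (∫ x, f x ∂μ₀)) := by
  obtain ⟨M, hM⟩ := hfc.isCompact.isBounded.subset_closedBall 0
  rw [Real.closedBall_eq_Icc, zero_sub, zero_add] at hM
  have hzero {x : ℝ} (hx : x < -M ∨ M < x) : f x = 0 := by
    by_contra h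
    have := hM (subset_tsupport f h)
    rcases hx with hx | hx
    · linarith [this.1]
    · linarith [this.2]
  have hsum {μ : Measure ℝ} (h1 : IsPointMeasure μ) (h2 : InfiniteBothDirections μ) {k l : ℤ}
      (hk : xLabel μ k < -M) (hl : M < xLabel μ l) :
      ∫ x, f x ∂μ = ∑ n ∈ Finset.Icc k l, f (xLabel μ n) := by
    refine h1.integral_eq_sum h2 hf hfc fun n hn ↦ hzero ?_
    have hmono := h1.monotone_xLabel h2
    rcases lt_or_ge n k with h | h
    · exact .inl ((hmono h.le).trans_lt hk)
    · refine .inr (hl.trans_le (hmono ?_))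
      simp only [Finset.mem_Icc, not_and, not_le] at hn
      exact (hn h).le
  obtain ⟨k, hk⟩ : ∃ k, xLabel μ₀ k < -M :=
    ⟨_, ((hμ.xLabel_le_iff hinf _ _).mpr le_rfl).trans_lt (sub_one_lt (-M))⟩
  obtain ⟨l, hl⟩ : ∃ l, M < xLabel μ₀ l := ⟨_, (hμ.lt_xLabel_iff hinf _ _).mpr (lt_add_one _)⟩
  have ht (n : ℤ) := tendsto_comap_apply xLabel μ₀
    {μ | IsPointMeasure μ ∧ InfiniteBothDirections μ} n
  rw [hsum hμ hinf hk hl]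
  refine (tendsto_finsetSum _ fun n _ ↦ (hf.tendsto _).comp (ht n)).congr' ?_
  filter_upwards [(ht k).eventually (gt_mem_nhds hk), (ht l).eventually (lt_mem_nhds hl),
    mem_inf_of_right (mem_principal_self _)] with μ h1 h2 h3
  exact (hsum h3.1 h3.2 h1 h2).symm

end Continuity

section Measurability

variable {Ω : Type*} [MeasurableSpace Ω] {P : Measure Ω} {ξ : Ω → Measure ℝ}

theorem aemeasurable_xLabel (hξ : Measurable ξ)
    (hpp : ∀ᵐ ω ∂P, IsPointMeasure (ξ ω) ∧ InfiniteBothDirections (ξ ω)) (n : ℤ) :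
    AEMeasurable (fun ω ↦ xLabel (ξ ω) n) P := by
  refine NullMeasurable.aemeasurable (measurable_of_Iic
    (f := fun ω : NullMeasurableSpace Ω P ↦ xLabel (ξ ω) n) fun t ↦ ?_)
  have hm : MeasurableSet {ω | n ≤ labelCount (ξ ω) t} :=
    measurableSet_le measurable_const ((measurable_labelCount t).comp hξ)
  refine hm.nullMeasurableSet.congr ?_
  filter_upwards [hpp] with ω hω
  exact propext (hω.1.xLabel_le_iff hω.2 n t).symm

theorem aemeasurable_integral (hξ : Measurable ξ) (hpp : ∀ᵐ ω ∂P, IsPointMeasure (ξ ω))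
    {f : ℝ → ℝ} (hf : Continuous f) (hfc : HasCompactSupport f) :
    AEMeasurable (fun ω ↦ ∫ x, f x ∂(ξ ω)) P := by
  have hm {g : ℝ → ℝ} (hg : Continuous g) :
      Measurable fun ω ↦ (∫⁻ x, ENNReal.ofReal (g x) ∂(ξ ω)).toReal :=
    ((Measure.measurable_lintegral hg.measurable.ennreal_ofReal).comp hξ).ennreal_toReal
  refine ((hm hf).sub (hm hf.neg)).aemeasurable.congr ?_
  filter_upwards [hpp] with ω hω
  have := hω.isLocallyFiniteMeasure
  exact (integral_eq_lintegral_pos_part_sub_lintegral_neg_part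
    (hf.integrable_of_hasCompactSupport hfc)).symm

end Measurability

/-- For point processes `ξ_ℓ`, `ξ`, almost surely infinite in both directions, with almost
surely `ξ({0}) = 0`, convergence in distribution (in the sense of linear statistics) is
equivalent to convergence in distribution of the vectors of labeled points
`(x_{-K}(ξ_ℓ), ..., x_K(ξ_ℓ))` for every `K ≥ 1`. -/
theorem stmt_2 {Ω : Type*} [MeasurableSpace Ω] (P : MeasureTheory.Measure Ω)
    [IsProbabilityMeasure P]
    (ξ : Ω → MeasureTheory.Measure ℝ) (ξs : ℕ → Ω → MeasureTheory.Measure ℝ)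
    (hmeas : Measurable ξ) (hmeass : ∀ ℓ, Measurable (ξs ℓ))
    (hpp : ∀ᵐ ω ∂P, IsPointMeasure (ξ ω) ∧ InfiniteBothDirections (ξ ω))
    (hpps : ∀ ℓ, ∀ᵐ ω ∂P, IsPointMeasure (ξs ℓ ω) ∧ InfiniteBothDirections (ξs ℓ ω))
    (h0 : ∀ᵐ ω ∂P, ξ ω {0} = 0) :
    (∀ f : ℝ → ℝ, Continuous f → HasCompactSupport f →
        ∀ g : BoundedContinuousFunction ℝ ℝ,
        Tendsto (fun ℓ => ∫ ω, g (∫ x, f x ∂(ξs ℓ ω)) ∂P) atTop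
          (𝓝 (∫ ω, g (∫ x, f x ∂(ξ ω)) ∂P))) ↔
    (∀ K : ℕ, 1 ≤ K → ∀ F : BoundedContinuousFunction (Fin (2 * K + 1) → ℝ) ℝ,
        Tendsto (fun ℓ => ∫ ω, F (fun i => xLabel (ξs ℓ ω) ((i.val : ℤ) - K)) ∂P) atTop
          (𝓝 (∫ ω, F (fun i => xLabel (ξ ω) ((i.val : ℤ) - K)) ∂P))) := by
  have hX (n : ℤ) := aemeasurable_xLabel hmeas hpp n
  have hXs (ℓ : ℕ) (n : ℤ) := aemeasurable_xLabel (hmeass ℓ) (hpps ℓ) n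
  have hI {f : ℝ → ℝ} (hf : Continuous f) (hfc : HasCompactSupport f) :=
    aemeasurable_integral hmeas (hpp.mono fun _ h ↦ h.1) hf hfc
  have hIs (ℓ : ℕ) {f : ℝ → ℝ} (hf : Continuous f) (hfc : HasCompactSupport f) :=
    aemeasurable_integral (hmeass ℓ) ((hpps ℓ).mono fun _ h ↦ h.1) hf hfc
  constructor
  · intro h K _
    rw [← tendstoInDistribution_iff_integral (fun ℓ ↦ aemeasurable_pi_lambda _ fun i ↦ hXs ℓ _)
      (aemeasurable_pi_lambda _ fun i ↦ hX _)]
    let := TopologicalSpace.pseudoMetrizableSpacePseudoMetric (ℚ × ℚ × ℕ → ℝ)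
    refine tendstoInDistribution_of_ae_tendsto_comap (φ := trapezoidIntegrals)
      (y := fun μ (i : Fin (2 * K + 1)) ↦ xLabel μ ((i.val : ℤ) - K))
      (S := {μ | IsPointMeasure μ ∧ InfiniteBothDirections μ}) ?_
      (fun ℓ ↦ aemeasurable_pi_lambda _ fun i ↦ hXs ℓ _)
      (aemeasurable_pi_lambda _ fun i ↦ hX _) hpps ?_
    · have hΦ : AEMeasurable (fun ω ↦ trapezoidIntegrals (ξ ω)) P := aemeasurable_pi_lambda _
        fun i ↦ hI (continuous_trapezoid i) (hasCompactSupport_trapezoid i)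
      have hΦs (ℓ : ℕ) : AEMeasurable (fun ω ↦ trapezoidIntegrals (ξs ℓ ω)) P :=
        aemeasurable_pi_lambda _
          fun i ↦ hIs ℓ (continuous_trapezoid i) (hasCompactSupport_trapezoid i)
      refine tendstoInDistribution_pi_of_finset_restrict hΦs hΦ fun s ↦ ?_
      refine tendstoInDistribution_pi_of_linear_combinations
        (fun ℓ ↦ (Finset.measurable_restrict s).comp_aemeasurable (hΦs ℓ))
        ((Finset.measurable_restrict s).comp_aemeasurable hΦ) fun t ↦ ?_
      have hf : Continuous fun x ↦ ∑ i : s, t i * trapezoid i x :=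
        continuous_finsetSum _ fun i _ ↦ continuous_const.mul (continuous_trapezoid i)
      have hfc : HasCompactSupport fun x ↦ ∑ i : s, t i * trapezoid i x := by
        refine HasCompactSupport.intro
          (isCompact_iUnion fun i : s ↦ hasCompactSupport_trapezoid i) fun x hx ↦ ?_
        refine Finset.sum_eq_zero fun i _ ↦ ?_
        rw [image_eq_zero_of_notMem_tsupport fun hi ↦ hx (Set.mem_iUnion.mpr ⟨i, hi⟩), mul_zero]
      have hlin {η : Ω → Measure ℝ}
          (hη : ∀ᵐ ω ∂P, IsPointMeasure (η ω) ∧ InfiniteBothDirections (η ω)) :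
          (fun ω ↦ ∫ x, ∑ i : s, t i * trapezoid i x ∂(η ω)) =ᵐ[P]
            fun ω ↦ ∑ i : s, t i * s.restrict (trapezoidIntegrals (η ω)) i := by
        filter_upwards [hη] with ω hω
        have := hω.1.isLocallyFiniteMeasure
        rw [integral_finsetSum _ fun (i : s) _ ↦ (integrable_trapezoid i.1 (η ω)).const_mul (t i)]
        simp only [integral_const_mul]
        rfl
      exact ((tendstoInDistribution_iff_integral (fun ℓ ↦ hIs ℓ hf hfc) (hI hf hfc)).mpr
        (h _ hf hfc)).congr (fun ℓ ↦ hlin (hpps ℓ)) (hlin hpp)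
    · filter_upwards [hpp, h0] with ω hω hω0
      exact tendsto_pi_nhds.mpr fun i ↦ hω.1.tendsto_xLabel hω.2 hω0 _
  · intro h f hf hfc
    rw [← tendstoInDistribution_iff_integral (fun ℓ ↦ hIs ℓ hf hfc) (hI hf hfc)]
    let := TopologicalSpace.pseudoMetrizableSpacePseudoMetric (ℤ → ℝ)
    refine tendstoInDistribution_of_ae_tendsto_comap (φ := xLabel) (y := fun μ ↦ ∫ x, f x ∂μ)
      (S := {μ | IsPointMeasure μ ∧ InfiniteBothDirections μ}) ?_
      (fun ℓ ↦ hIs ℓ hf hfc) (hI hf hfc) hpps ?_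
    · refine tendstoInDistribution_pi_of_finset_restrict
        (fun ℓ ↦ aemeasurable_pi_lambda _ (hXs ℓ)) (aemeasurable_pi_lambda _ hX) fun s ↦ ?_
      let K : ℕ := s.sup Int.natAbs + 1
      have hK (i : s) : (i.1 + K).toNat < 2 * K + 1 ∧ ((i.1 + K).toNat : ℤ) - K = i := by
        have : i.1.natAbs ≤ s.sup Int.natAbs := Finset.le_sup i.2
        omega
      have hvec := (tendstoInDistribution_iff_integral
        (fun ℓ ↦ aemeasurable_pi_lambda _ fun i ↦ hXs ℓ _)
        (aemeasurable_pi_lambda _ fun i ↦ hX _)).mpr (h K (Nat.le_add_left 1 _))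
      have hproj : Continuous fun (v : Fin (2 * K + 1) → ℝ) (i : s) ↦
          v ⟨(i.1 + K).toNat, (hK i).1⟩ := by fun_prop
      have hcomp := hvec.continuous_comp hproj
      simp only [Function.comp_def, (hK _).2] at hcomp
      exact hcomp
    · filter_upwards [hpp] with ω hω
      exact hω.1.tendsto_integral hω.2 hf hfc
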